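/- (Null space of the reflection-positive form, part of Proposition 2.3.) Let λ > 0 and let f : ℝ³ → ℝ² ⊗ ℝ^d be smooth compactly supported with supp f ⊂ ℝ³₊. Then ⟨A(f)A(rRf)⟩₀ = 0 if and only if π(f) = 0. Hence the null space of the positive semidefinite form f ↦ ⟨A(f)A(rRf)⟩₀ on C_c^∞(ℝ³₊) ⊗ ℝ² ⊗ ℝ^d is exactly the kernel of π. -/

import Mathlib

open MeasureTheory

/-- The function `u`: `u(s) = 1/2` for `s ≥ 0`, `u(s) = -1/2` for `s < 0`. -/
noncomputable def uStep (s : ℝ) : ℝ := if 0 ≤ s then 1/2 else -1/2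

/-- The antisymmetric symbol `ε_{ij}` on `Fin 2`, with `ε₀₁ = 1`. -/
noncomputable def epsSym : Fin 2 → Fin 2 → ℝ :=
  fun i j => (!![0, 1; -1, 0] : Matrix (Fin 2) (Fin 2) ℝ) i j

/-- The propagator pairing `⟨A(f)A(g)⟩₀`. -/
noncomputable def pairing (d : ℕ) (lam : ℝ)
    (f g : (Fin 2 → ℝ) × ℝ → Fin 2 → Fin d → ℝ) : ℝ :=
  -lam⁻¹ * ∑ α : Fin d, ∑ i : Fin 2, ∑ j : Fin 2, epsSym i j *
    ∫ p : ((Fin 2 → ℝ) × ℝ × ℝ),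
      f (p.1, p.2.1) i α * g (p.1, p.2.2) j α * uStep (p.2.1 - p.2.2)

/-- `π(f)(x) = ∫ f(x,t) dt`, componentwise. -/
noncomputable def piMap (d : ℕ) (f : (Fin 2 → ℝ) × ℝ → Fin 2 → Fin d → ℝ) :
    (Fin 2 → ℝ) → Fin 2 → Fin d → ℝ :=
  fun x i α => ∫ t : ℝ, f (x, t) i α

/-- The rotation `r`: `(r f)¹ = f²`, `(r f)² = −f¹`. -/
def rMap (d : ℕ) (f : (Fin 2 → ℝ) × ℝ → Fin 2 → Fin d → ℝ) :
    (Fin 2 → ℝ) × ℝ → Fin 2 → Fin d → ℝ :=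
  fun p => ![f p 1, -(f p 0)]

/-- The `L²(ℝ²; ℝ² ⊗ ℝ^d)` inner product. -/
noncomputable def l2Inner (d : ℕ) (F G : (Fin 2 → ℝ) → Fin 2 → Fin d → ℝ) : ℝ :=
  ∫ x : Fin 2 → ℝ, ∑ i : Fin 2, ∑ α : Fin d, F x i α * G x i α


/-- The reflection `R`: `(R f)(x,t) = f(x,−t)`. -/
def RMap (d : ℕ) (f : (Fin 2 → ℝ) × ℝ → Fin 2 → Fin d → ℝ) :
    (Fin 2 → ℝ) × ℝ → Fin 2 → Fin d → ℝ :=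
  fun p => f (p.1, -p.2)

/-- For `φ` supported in the open upper half-space, `u(t - s) = 1/2` wherever
`φ (x, t) * φ (x, -s)` does not vanish. -/
theorem mul_reflect_mul_uStep {X : Type*} {φ : X × ℝ → ℝ}
    (hpos : ∀ p, p.2 ≤ 0 → φ p = 0) (x : X) (t s : ℝ) :
    φ (x, t) * φ (x, -s) * uStep (t - s) = φ (x, t) * φ (x, -s) * (1 / 2) := by
  rcases le_or_gt t 0 with ht | ht
  · simp [hpos (x, t) ht]
  rcases le_or_gt (-s) 0 with hs | hs
  · simp [hpos (x, -s) hs]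
  rw [uStep, if_pos (by linarith)]

section Fiber

variable {X : Type*} [TopologicalSpace X] {φ : X × ℝ → ℝ}

theorem continuous_integral_fiber
    (hc : Continuous φ) (hs : HasCompactSupport φ) :
    Continuous fun x => ∫ t : ℝ, φ (x, t) := by
  rw [← continuousOn_univ]
  refine continuousOn_integral_of_compact_support (k := Prod.snd '' tsupport φ)
    (hs.isCompact.image continuous_snd) (hc.comp (by fun_prop)).continuousOn ?_
  intro x t _ ht
  by_contra h
  exact ht ⟨(x, t), subset_tsupport _ h, rfl⟩

theorem hasCompactSupport_mul_reflect [R1Space X] (hs : HasCompactSupport φ) :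
    HasCompactSupport fun p : X × ℝ × ℝ => φ (p.1, p.2.1) * φ (p.1, -p.2.2) := by
  have hK : IsCompact ((fun q : (X × ℝ) × (X × ℝ) => (q.1.1, q.1.2, -q.2.2)) ''
      (tsupport φ ×ˢ tsupport φ)) :=
    (hs.isCompact.prod hs.isCompact).image (by fun_prop)
  refine HasCompactSupport.intro hK fun p hp => ?_
  by_contra h
  refine hp ⟨((p.1, p.2.1), (p.1, -p.2.2)), ⟨?_, ?_⟩, by simp⟩
  · exact subset_tsupport _ (left_ne_zero_of_mul h)
  · exact subset_tsupport _ (right_ne_zero_of_mul h)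

end Fiber

section Scalar

variable {φ : (Fin 2 → ℝ) × ℝ → ℝ}

theorem integrable_mul_reflect (hc : Continuous φ) (hs : HasCompactSupport φ) :
    Integrable fun p : (Fin 2 → ℝ) × ℝ × ℝ => φ (p.1, p.2.1) * φ (p.1, -p.2.2) :=
  Continuous.integrable_of_hasCompactSupport (by fun_prop) (hasCompactSupport_mul_reflect hs)

theorem integral_fiber_mul_reflect (x : Fin 2 → ℝ) :
    ∫ q : ℝ × ℝ, φ (x, q.1) * φ (x, -q.2) = (∫ t : ℝ, φ (x, t)) ^ 2 := by
  rw [Measure.volume_eq_prod, integral_prod_mul (fun t => φ (x, t)) fun t => φ (x, -t),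
    integral_neg_eq_self (fun t => φ (x, t)), sq]

theorem integrable_sq_integral_fiber (hc : Continuous φ) (hs : HasCompactSupport φ) :
    Integrable fun x : Fin 2 → ℝ => (∫ t : ℝ, φ (x, t)) ^ 2 := by
  have h := (integrable_mul_reflect hc hs).integral_prod_left
  simpa only [← Measure.volume_eq_prod, integral_fiber_mul_reflect] using h

theorem integral_mul_reflect_mul_uStep (hc : Continuous φ) (hs : HasCompactSupport φ)
    (hpos : ∀ p, p.2 ≤ 0 → φ p = 0) :
    ∫ p : (Fin 2 → ℝ) × ℝ × ℝ, φ (p.1, p.2.1) * φ (p.1, -p.2.2) * uStep (p.2.1 - p.2.2) =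
      (∫ x : Fin 2 → ℝ, (∫ t : ℝ, φ (x, t)) ^ 2) * (1 / 2) := by
  simp only [mul_reflect_mul_uStep hpos]
  rw [integral_mul_const, Measure.volume_eq_prod, integral_prod _ (integrable_mul_reflect hc hs)]
  simp only [integral_fiber_mul_reflect]

theorem integral_sq_integral_fiber_eq_zero_iff (hc : Continuous φ) (hs : HasCompactSupport φ) :
    ∫ x : Fin 2 → ℝ, (∫ t : ℝ, φ (x, t)) ^ 2 = 0 ↔ ∀ x : Fin 2 → ℝ, ∫ t : ℝ, φ (x, t) = 0 := by
  rw [integral_eq_zero_iff_of_nonneg (fun x => sq_nonneg _) (integrable_sq_integral_fiber hc hs),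
    Continuous.ae_eq_iff_eq (f := fun x => (∫ t : ℝ, φ (x, t)) ^ 2) _
      ((continuous_integral_fiber hc hs).pow 2) continuous_zero]
  simp [funext_iff]

end Scalar

section Pairing

variable {d : ℕ} {f : (Fin 2 → ℝ) × ℝ → Fin 2 → Fin d → ℝ}

theorem hasCompactSupport_component (hs : HasCompactSupport f) (i : Fin 2) (α : Fin d) :
    HasCompactSupport fun p => f p i α :=
  hs.comp_left (g := fun v : Fin 2 → Fin d → ℝ => v i α) rfl

theorem pairing_rMap_RMap (lam : ℝ) (hc : Continuous f) (hs : HasCompactSupport f)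
    (hpos : tsupport f ⊆ {p : (Fin 2 → ℝ) × ℝ | 0 < p.2}) :
    pairing d lam f (rMap d (RMap d f)) =
      lam⁻¹ / 2 * ∑ α : Fin d, ∑ i : Fin 2, ∫ x : Fin 2 → ℝ, piMap d f x i α ^ 2 := by
  have key (i : Fin 2) (α : Fin d) := integral_mul_reflect_mul_uStep (φ := fun p => f p i α)
    (by fun_prop) (hasCompactSupport_component hs i α) fun p hp => by
      rw [image_eq_zero_of_notMem_tsupport fun h => not_lt.2 hp (hpos h)]
      rfl
  simp only [pairing, piMap, Fin.sum_univ_two, epsSym, rMap, RMap, Finset.mul_sum]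
  refine Finset.sum_congr rfl fun α _ => ?_
  simp [integral_neg, key]
  ring

theorem pairing_rMap_RMap_eq_zero_iff {lam : ℝ} (hlam : 0 < lam)
    (hc : Continuous f) (hs : HasCompactSupport f)
    (hpos : tsupport f ⊆ {p : (Fin 2 → ℝ) × ℝ | 0 < p.2}) :
    pairing d lam f (rMap d (RMap d f)) = 0 ↔ piMap d f = 0 := by
  have key (i : Fin 2) (α : Fin d) := integral_sq_integral_fiber_eq_zero_iff
    (φ := fun p => f p i α) (by fun_prop) (hasCompactSupport_component hs i α)
  have hnonneg (i : Fin 2) (α : Fin d) : 0 ≤ ∫ x : Fin 2 → ℝ, piMap d f x i α ^ 2 :=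
    integral_nonneg fun x => sq_nonneg _
  rw [pairing_rMap_RMap lam hc hs hpos, mul_eq_zero_iff_left (by positivity),
    Finset.sum_eq_zero_iff_of_nonneg fun α _ => Finset.sum_nonneg fun i _ => hnonneg i α]
  have hsum (α : Fin d) : ∑ i : Fin 2, ∫ x : Fin 2 → ℝ, piMap d f x i α ^ 2 = 0 ↔
      ∀ (i : Fin 2) (x : Fin 2 → ℝ), piMap d f x i α = 0 := by
    rw [Finset.sum_eq_zero_iff_of_nonneg fun i _ => hnonneg i α]
    simp only [Finset.mem_univ, true_imp_iff, piMap, key]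
  simp only [Finset.mem_univ, true_imp_iff, hsum, funext_iff, Pi.zero_apply]
  exact ⟨fun h x i α => h α i x, fun h α i x => h x i α⟩

end Pairing

/-- Null space of the reflection-positive form: for `λ > 0` and `supp f ⊂ ℝ³₊`,
`⟨A(f)A(rRf)⟩₀ = 0` iff `π(f) = 0`.  Hence the null space of the positive semidefinite
form `f ↦ ⟨A(f)A(rRf)⟩₀` on `C_c^∞(ℝ³₊) ⊗ ℝ² ⊗ ℝ^d` is exactly the kernel of `π`. -/
theorem nullspace_of_reflection_form
    (d : ℕ) (hd : 1 ≤ d) (lam : ℝ) (hlam : 0 < lam) :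
    (∀ f : (Fin 2 → ℝ) × ℝ → Fin 2 → Fin d → ℝ,
      ContDiff ℝ (⊤ : ℕ∞) f → HasCompactSupport f →
      tsupport f ⊆ {p : (Fin 2 → ℝ) × ℝ | 0 < p.2} →
      (pairing d lam f (rMap d (RMap d f)) = 0 ↔ piMap d f = 0)) ∧
    {f : (Fin 2 → ℝ) × ℝ → Fin 2 → Fin d → ℝ |
        ContDiff ℝ (⊤ : ℕ∞) f ∧ HasCompactSupport f ∧
        tsupport f ⊆ {p : (Fin 2 → ℝ) × ℝ | 0 < p.2} ∧
        pairing d lam f (rMap d (RMap d f)) = 0} =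
      {f : (Fin 2 → ℝ) × ℝ → Fin 2 → Fin d → ℝ |
        ContDiff ℝ (⊤ : ℕ∞) f ∧ HasCompactSupport f ∧
        tsupport f ⊆ {p : (Fin 2 → ℝ) × ℝ | 0 < p.2} ∧
        piMap d f = 0} := by
  have key (f : (Fin 2 → ℝ) × ℝ → Fin 2 → Fin d → ℝ) (hf : ContDiff ℝ (⊤ : ℕ∞) f)
      (hs : HasCompactSupport f) (hpos : tsupport f ⊆ {p : (Fin 2 → ℝ) × ℝ | 0 < p.2}) :=
    pairing_rMap_RMap_eq_zero_iff hlam hf.continuous hs hpos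
  refine ⟨key, Set.ext fun f => ?_⟩
  simp only [Set.mem_ofPred_eq]
  exact and_congr_right fun hf => and_congr_right fun hs => and_congr_right fun hpos =>
    key f hf hs hpos
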